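/- arXiv:1509.03864 — 6 statements merged into one kernel-verified Lean document; each statement's English description precedes it below -/
import Mathlib

section
/- Suppose β ∈ (0,1). Then for every b ∈ (0,1), both the scale measure S(0,b] = ∫_0^b s(y) dy and the speed measure M(0,b] = ∫_0^b m(y) dy are finite. (This is the analytic content of Lemma 4.1(1): when β ∈ (0,1), the origin is a regular boundary for the diffusion X^{(d)}.) -/
open MeasureTheory Set

/-- The scale density `s(y) = exp(∫_y^1 2 b_d(η) / (η^β a(η)) dη)`. -/
noncomputable def scaleDensity (β : ℝ) (bd a : ℝ → ℝ) (y : ℝ) : ℝ :=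
  Real.exp (∫ η in y..1, 2 * bd η / (η ^ β * a η))

/-- The speed density `m(y) = 1 / (y^β a(y) s(y))`. -/
noncomputable def speedDensity (β : ℝ) (bd a : ℝ → ℝ) (y : ℝ) : ℝ :=
  1 / (y ^ β * a y * scaleDensity β bd a y)

/-- If `β ∈ (0,1)`, then for every `b ∈ (0,1)` both the scale measure
`S(0,b] = ∫_0^b s(y) dy` and the speed measure `M(0,b] = ∫_0^b m(y) dy` are finite. -/
theorem scale_and_speed_measure_finite_of_beta_lt_one
    (β δ : ℝ) (hβ : β ∈ Set.Ioo (0 : ℝ) 1) (hδ : 0 < δ)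
    (bd a : ℝ → ℝ) (hbd : ContinuousOn bd (Set.Icc 0 1))
    (ha : ContinuousOn a (Set.Icc 0 1))
    (haδ : ∀ y ∈ Set.Icc (0 : ℝ) 1, δ ≤ a y) :
    ∀ b ∈ Set.Ioo (0 : ℝ) 1,
      (∫⁻ y in Set.Ioc (0 : ℝ) b, ENNReal.ofReal (scaleDensity β bd a y)) < ⊤ ∧
      (∫⁻ y in Set.Ioc (0 : ℝ) b, ENNReal.ofReal (speedDensity β bd a y)) < ⊤ := by
  intro b hb
  obtain ⟨hβ0, hβ1⟩ := hβ
  obtain ⟨hb0, hb1⟩ := hb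
  obtain ⟨B, hB⟩ := isCompact_Icc.exists_bound_of_continuousOn hbd
  have hB0 : 0 ≤ B := (norm_nonneg _).trans (hB 0 (by simp))
  have hint : ∀ x y : ℝ, IntervalIntegrable (fun η : ℝ => 2 * B / δ * η ^ (-β)) volume x y :=
    fun x y => (intervalIntegral.intervalIntegrable_rpow' (by linarith)).const_mul _
  set C : ℝ := ∫ η in (0:ℝ)..1, 2 * B / δ * η ^ (-β) with hC
  have hbound : ∀ y ∈ Set.Ioc (0:ℝ) b,
      |∫ η in y..1, 2 * bd η / (η ^ β * a η)| ≤ C := by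
    intro y hy
    have hy1 : y ≤ 1 := hy.2.trans hb1.le
    have h1 : ‖∫ η in y..1, 2 * bd η / (η ^ β * a η)‖ ≤
        ∫ η in y..1, 2 * B / δ * η ^ (-β) := by
      refine intervalIntegral.norm_integral_le_of_norm_le hy1 ?_ (hint _ _)
      refine Filter.Eventually.of_forall fun t ht => ?_
      have ht0 : 0 < t := hy.1.trans ht.1
      have htm : t ∈ Set.Icc (0:ℝ) 1 := ⟨ht0.le, ht.2⟩
      have hp : 0 < t ^ β := Real.rpow_pos_of_pos ht0 _
      have hat := haδ t htm
      have hat : 0 < a t := hδ.trans_le hat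
      have hBt := hB t htm
      rw [norm_div, norm_mul, norm_mul, Real.norm_of_nonneg hp.le, Real.norm_of_nonneg hat.le,
        Real.rpow_neg ht0.le, Real.norm_of_nonneg (by norm_num : (0:ℝ) ≤ 2)]
      calc 2 * ‖bd t‖ / (t ^ β * a t) ≤ 2 * B / (t ^ β * δ) := by gcongr
        _ = 2 * B / δ * (t ^ β)⁻¹ := by field_simp
    refine h1.trans ?_
    refine intervalIntegral.integral_mono_interval hy.1.le hy1 le_rfl ?_ (hint _ _)
    refine (ae_restrict_iff' measurableSet_Ioc).2 (Filter.Eventually.of_forall fun t ht => ?_)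
    have ht0 : 0 < t := ht.1
    simp only [Pi.zero_apply]
    positivity
  constructor
  · calc (∫⁻ y in Set.Ioc (0 : ℝ) b, ENNReal.ofReal (scaleDensity β bd a y))
        ≤ ∫⁻ y in Set.Ioc (0 : ℝ) b, ENNReal.ofReal (Real.exp C) := by
          refine setLIntegral_mono measurable_const fun y hy => ?_
          exact ENNReal.ofReal_le_ofReal (Real.exp_le_exp.2 ((le_abs_self _).trans (hbound y hy)))
      _ < ⊤ := by
          rw [setLIntegral_const, Real.volume_Ioc]
          exact ENNReal.mul_lt_top ENNReal.ofReal_lt_top ENNReal.ofReal_lt_top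
  · have hI : IntegrableOn (fun y : ℝ => Real.exp C / δ * y ^ (-β)) (Set.Ioc 0 b) volume :=
      (intervalIntegrable_iff_integrableOn_Ioc_of_le hb0.le).1
        ((intervalIntegral.intervalIntegrable_rpow' (by linarith)).const_mul _)
    have hfin : (∫⁻ y in Set.Ioc (0 : ℝ) b, ENNReal.ofReal (Real.exp C / δ * y ^ (-β))) < ⊤ :=
      hI.lintegral_lt_top
    refine lt_of_le_of_lt ?_ hfin
    refine setLIntegral_mono' measurableSet_Ioc fun y hy => ENNReal.ofReal_le_ofReal ?_
    have hy0 : 0 < y := hy.1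
    have hp : 0 < y ^ β := Real.rpow_pos_of_pos hy0 _
    have hs : Real.exp (-C) ≤ scaleDensity β bd a y :=
      Real.exp_le_exp.2 (neg_le_of_abs_le (hbound y hy))
    have hay := haδ y ⟨hy0.le, hy.2.trans hb1.le⟩
    have he := Real.exp_pos (-C)
    rw [Real.rpow_neg hy0.le]
    calc speedDensity β bd a y ≤ 1 / (y ^ β * δ * Real.exp (-C)) := by
          unfold speedDensity
          gcongr
          exact mul_nonneg hp.le (hδ.le.trans hay)
      _ = Real.exp C / δ * (y ^ β)⁻¹ := by
          rw [Real.exp_neg]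
          field_simp
end

section
/- Suppose β ∈ (1,2], b_d(0) > 0, and there exist constants γ ∈ (0,1], L > 0 and κ ∈ (0,1) such that |b_d(y) − b_d(0)| ≤ L y^γ for all y ∈ [0,κ]. Then for every b ∈ (0,1), the scale measure S(0,b] = ∫_0^b s(y) dy is infinite. (This is the analytic content of Lemma 4.1(2): when β ∈ (1,2], the origin is a non-attracting natural or entrance boundary for the diffusion X^{(d)}, which never reaches 0 from the interior.) -/
open MeasureTheory Set

/-- If `β ∈ (1,2]`, `b_d(0) > 0` and `b_d` is locally Hölder continuous at the origin,
then for every `b ∈ (0,1)` the scale measure `S(0,b] = ∫_0^b s(y) dy` is infinite. -/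
theorem scale_measure_infinite_of_one_lt_beta
    (β δ : ℝ) (hβ : β ∈ Set.Ioc (1 : ℝ) 2) (hδ : 0 < δ)
    (bd a : ℝ → ℝ) (hbd : ContinuousOn bd (Set.Icc 0 1))
    (ha : ContinuousOn a (Set.Icc 0 1))
    (haδ : ∀ y ∈ Set.Icc (0 : ℝ) 1, δ ≤ a y)
    (hbd0 : 0 < bd 0)
    (γ L κ : ℝ) (hγ : γ ∈ Set.Ioc (0 : ℝ) 1) (hL : 0 < L) (hκ : κ ∈ Set.Ioo (0 : ℝ) 1)
    (hholder : ∀ y ∈ Set.Icc (0 : ℝ) κ, |bd y - bd 0| ≤ L * y ^ γ) :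
    ∀ b ∈ Set.Ioo (0 : ℝ) 1,
      (∫⁻ y in Set.Ioc (0 : ℝ) b, ENNReal.ofReal (scaleDensity β bd a y)) = ⊤ := by
  intro b hb
  obtain ⟨hβ1, hβ2⟩ := hβ
  obtain ⟨hb0, hb1⟩ := hb
  -- near the origin, the integrand dominates `1 / η`
  have hcont : ContinuousWithinAt (fun η : ℝ => 2 * bd η - a η * η ^ (β - 1)) (Icc 0 1) 0 := by
    have h0 : (0 : ℝ) ∈ Icc (0 : ℝ) 1 := ⟨le_rfl, zero_le_one⟩
    have h1 := hbd 0 h0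
    have h2 := ha 0 h0
    have h3 : ContinuousWithinAt (fun η : ℝ => η ^ (β - 1)) (Icc 0 1) 0 :=
      (Real.continuousAt_rpow_const 0 (β - 1) (Or.inr (by linarith))).continuousWithinAt
    exact (continuousWithinAt_const.mul h1).sub (h2.mul h3)
  have hev : ∀ᶠ η in nhdsWithin (0 : ℝ) (Icc 0 1), 0 < 2 * bd η - a η * η ^ (β - 1) := by
    apply hcont.eventually_const_lt
    beta_reduce
    rw [Real.zero_rpow (by linarith)]
    linarith
  obtain ⟨r, hr, hball⟩ := Metric.mem_nhdsWithin_iff.1 hev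
  obtain ⟨ε, hε0, hεr, hεb⟩ : ∃ ε : ℝ, 0 < ε ∧ ε < r ∧ ε ≤ b :=
    ⟨min (r / 2) b, lt_min (by linarith) hb0,
      lt_of_le_of_lt (min_le_left _ _) (by linarith), min_le_right _ _⟩
  have hlow : ∀ η ∈ Ioc (0 : ℝ) ε, η⁻¹ ≤ 2 * bd η / (η ^ β * a η) := by
    intro η hη
    have hmem : η ∈ Icc (0 : ℝ) 1 := ⟨hη.1.le, by linarith [hη.2]⟩
    have h1 : 0 < 2 * bd η - a η * η ^ (β - 1) := by
      apply hball
      refine ⟨?_, hmem⟩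
      rw [Metric.mem_ball, Real.dist_eq, sub_zero, abs_of_pos hη.1]
      linarith [hη.2]
    have ha0 : 0 < a η := lt_of_lt_of_le hδ (haδ η hmem)
    have hp : 0 < η ^ β := Real.rpow_pos_of_pos hη.1 _
    have hpe : η ^ (β - 1) = η ^ β / η := by
      rw [Real.rpow_sub hη.1, Real.rpow_one]
    rw [le_div_iff₀ (mul_pos hp ha0)]
    rw [hpe] at h1
    have : η⁻¹ * (η ^ β * a η) = a η * (η ^ β / η) := by
      rw [div_eq_mul_inv]; ring
    linarith
  have hint : ∀ x y : ℝ, 0 < x → x ≤ y → y ≤ 1 →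
      IntervalIntegrable (fun η => 2 * bd η / (η ^ β * a η)) volume x y := by
    intro x y hx hxy hy
    apply ContinuousOn.intervalIntegrable
    rw [uIcc_of_le hxy]
    have hsub : Icc x y ⊆ Icc (0 : ℝ) 1 := Icc_subset_Icc hx.le hy
    apply ContinuousOn.div
    · exact continuousOn_const.mul (hbd.mono hsub)
    · apply ContinuousOn.mul _ (ha.mono hsub)
      exact continuousOn_id.rpow_const (fun z hz => Or.inr (by linarith))
    · intro z hz
      exact (mul_pos (Real.rpow_pos_of_pos (lt_of_lt_of_le hx hz.1) _)
        (lt_of_lt_of_le hδ (haδ z (hsub hz)))).ne'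
  set K : ℝ := ∫ η in ε..1, 2 * bd η / (η ^ β * a η) with hK
  have hs : ∀ y ∈ Ioc (0 : ℝ) ε, (Real.exp K * ε) * y⁻¹ ≤ scaleDensity β bd a y := by
    intro y hy
    have h1 : (∫ η in y..ε, η⁻¹) ≤ ∫ η in y..ε, 2 * bd η / (η ^ β * a η) := by
      apply intervalIntegral.integral_mono_on hy.2
      · apply intervalIntegrable_inv_iff.2
        right
        rw [uIcc_of_le hy.2]
        exact fun h => absurd h.1 (not_le.2 hy.1)
      · exact hint y ε hy.1 hy.2 (by linarith)
      · intro z hz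
        exact hlow z ⟨lt_of_lt_of_le hy.1 hz.1, hz.2⟩
    rw [integral_inv_of_pos hy.1 hε0] at h1
    have h2 := intervalIntegral.integral_add_adjacent_intervals
      (hint y ε hy.1 hy.2 (by linarith)) (hint ε 1 hε0 (by linarith) le_rfl)
    unfold scaleDensity
    rw [← h2, ← hK, Real.exp_add]
    have h3 : ε / y ≤ Real.exp (∫ η in y..ε, 2 * bd η / (η ^ β * a η)) := by
      rw [← Real.exp_log (div_pos hε0 hy.1)]
      exact Real.exp_le_exp.2 h1
    calc (Real.exp K * ε) * y⁻¹ = (ε / y) * Real.exp K := by rw [div_eq_mul_inv]; ring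
      _ ≤ _ := mul_le_mul_of_nonneg_right h3 (Real.exp_pos _).le
  have hC : 0 < Real.exp K * ε := mul_pos (Real.exp_pos _) hε0
  have hinf : (∫⁻ y in Ioc (0 : ℝ) ε, ENNReal.ofReal ((Real.exp K * ε) * y⁻¹)) = ⊤ := by
    by_contra hne
    have hmeas : Measurable (fun y : ℝ => (Real.exp K * ε) * y⁻¹) :=
      measurable_const.mul measurable_inv
    have hnn : 0 ≤ᵐ[volume.restrict (Ioc (0 : ℝ) ε)] fun y : ℝ => (Real.exp K * ε) * y⁻¹ := by
      filter_upwards [ae_restrict_mem measurableSet_Ioc] with y hy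
      exact mul_nonneg hC.le (inv_nonneg.2 hy.1.le)
    have hI : IntegrableOn (fun y : ℝ => (Real.exp K * ε) * y⁻¹) (Ioc 0 ε) :=
      (lintegral_ofReal_ne_top_iff_integrable hmeas.aestronglyMeasurable hnn).1 hne
    have hJ : IntegrableOn (fun y : ℝ => y⁻¹) (Ioc 0 ε) := by
      have := hI.const_mul (Real.exp K * ε)⁻¹
      refine this.congr (Filter.Eventually.of_forall fun y => ?_)
      exact inv_mul_cancel_left₀ hC.ne' _
    have := intervalIntegrable_inv_iff.1
      ((intervalIntegrable_iff_integrableOn_Ioc_of_le hε0.le).2 hJ)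
    rcases this with h | h
    · exact hε0.ne h
    · exact h left_mem_uIcc
  rw [eq_top_iff, ← hinf]
  calc _ ≤ ∫⁻ y in Ioc (0 : ℝ) ε, ENNReal.ofReal (scaleDensity β bd a y) :=
        setLIntegral_mono' measurableSet_Ioc fun y hy => ENNReal.ofReal_le_ofReal (hs y hy)
    _ ≤ _ := lintegral_mono_set (Ioc_subset_Ioc_right hεb)
end

section
/- Suppose β = 1, b_d(0) > 0, 2 b_d(0) > a(0), and there exist constants γ ∈ (0,1], L > 0 and κ ∈ (0,1) such that |b_d(y) − b_d(0)| ≤ L y^γ for all y ∈ [0,κ]. Then for every b ∈ (0,1), the scale measure S(0,b] = ∫_0^b s(y) dy is infinite. (This is the analytic content of Lemma 4.1(3)(i): the origin is a non-attracting natural or entrance boundary for the diffusion X^{(d)}.) -/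
open MeasureTheory Set

/-- If `β = 1`, `b_d(0) > 0`, `2 b_d(0) > a(0)` and `b_d` is locally Hölder continuous at
the origin, then for every `b ∈ (0,1)` the scale measure `S(0,b] = ∫_0^b s(y) dy`
is infinite. -/
theorem scale_measure_infinite_of_beta_eq_one_supercritical
    (δ : ℝ) (hδ : 0 < δ)
    (bd a : ℝ → ℝ) (hbd : ContinuousOn bd (Set.Icc 0 1))
    (ha : ContinuousOn a (Set.Icc 0 1))
    (haδ : ∀ y ∈ Set.Icc (0 : ℝ) 1, δ ≤ a y)
    (hbd0 : 0 < bd 0) (hsuper : a 0 < 2 * bd 0)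
    (γ L κ : ℝ) (hγ : γ ∈ Set.Ioc (0 : ℝ) 1) (hL : 0 < L) (hκ : κ ∈ Set.Ioo (0 : ℝ) 1)
    (hholder : ∀ y ∈ Set.Icc (0 : ℝ) κ, |bd y - bd 0| ≤ L * y ^ γ) :
    ∀ b ∈ Set.Ioo (0 : ℝ) 1,
      (∫⁻ y in Set.Ioc (0 : ℝ) b, ENNReal.ofReal (scaleDensity 1 bd a y)) = ⊤ := by
  intro b hb
  obtain ⟨hb0, hb1⟩ := hb
  have h0 : (0:ℝ) ∈ Icc (0:ℝ) 1 := ⟨le_rfl, zero_le_one⟩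
  have hev : ∀ᶠ y in nhdsWithin (0:ℝ) (Icc 0 1), a y < 2 * bd y :=
    (ha 0 h0).eventually_lt ((hbd 0 h0).const_mul 2) hsuper
  rw [eventually_nhdsWithin_iff, Metric.eventually_nhds_iff] at hev
  obtain ⟨r, hr, hev⟩ := hev
  obtain ⟨ε, hε0, hεr, hεb⟩ : ∃ ε : ℝ, 0 < ε ∧ ε < r ∧ ε ≤ b :=
    ⟨min (r/2) b, lt_min (by linarith) hb0,
      lt_of_le_of_lt (min_le_left _ _) (by linarith), min_le_right _ _⟩
  have hlt : ∀ y ∈ Icc (0:ℝ) ε, a y < 2 * bd y := by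
    intro y hy
    apply hev
    · rw [Real.dist_eq, sub_zero, abs_of_nonneg hy.1]; linarith [hy.2]
    · exact ⟨hy.1, by linarith [hy.2]⟩
  set f : ℝ → ℝ := fun η => 2 * bd η / (η ^ (1:ℝ) * a η) with hf
  have hfc : ContinuousOn f (Ioc 0 1) := by
    have hsub : Ioc (0:ℝ) 1 ⊆ Icc 0 1 := Ioc_subset_Icc_self
    apply ContinuousOn.div
    · exact (continuousOn_const.mul (hbd.mono hsub))
    · simp only [Real.rpow_one]
      exact continuousOn_id.mul (ha.mono hsub)
    · intro x hx
      have := haδ x (hsub hx)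
      have h1 : 0 < a x := by linarith
      have h2 := hx.1
      simp only [Real.rpow_one]
      positivity
  have hfi : ∀ u v : ℝ, 0 < u → u ≤ v → v ≤ 1 → IntervalIntegrable f volume u v := by
    intro u v hu huv hv
    apply ContinuousOn.intervalIntegrable
    rw [uIcc_of_le huv]
    exact hfc.mono fun x hx => ⟨lt_of_lt_of_le hu hx.1, hx.2.trans hv⟩
  set C : ℝ := ∫ η in ε..1, f η with hC
  have hs : ∀ y ∈ Ioc (0:ℝ) ε, Real.exp C * ε * y⁻¹ ≤ scaleDensity 1 bd a y := by
    intro y hy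
    obtain ⟨hy0, hy1⟩ := hy
    have hsplit : ∫ η in y..1, f η = (∫ η in y..ε, f η) + C :=
      (intervalIntegral.integral_add_adjacent_intervals
        (hfi y ε hy0 hy1 (by linarith)) (hfi ε 1 hε0 (by linarith) le_rfl)).symm
    have hlog : Real.log (ε / y) ≤ ∫ η in y..ε, f η := by
      rw [← integral_inv_of_pos hy0 hε0]
      apply intervalIntegral.integral_mono_on hy1
      · apply ContinuousOn.intervalIntegrable
        rw [uIcc_of_le hy1]
        exact continuousOn_inv₀.mono fun x hx => (lt_of_lt_of_le hy0 hx.1).ne'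
      · exact hfi y ε hy0 hy1 (by linarith)
      · intro x hx
        have hx0 : 0 < x := lt_of_lt_of_le hy0 hx.1
        have h1 := haδ x ⟨hx0.le, by linarith [hx.2]⟩
        have h2 : 0 < a x := by linarith
        have h3 := hlt x ⟨hx0.le, hx.2⟩
        simp only [hf, Real.rpow_one]
        rw [inv_eq_one_div, div_le_div_iff₀ hx0 (by positivity)]
        nlinarith
    have : Real.exp C * ε * y⁻¹ = Real.exp (Real.log (ε / y) + C) := by
      rw [Real.exp_add, Real.exp_log (by positivity)]
      field_simp
    rw [this]
    unfold scaleDensity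
    apply Real.exp_le_exp.mpr
    change _ ≤ ∫ η in y..1, f η
    rw [hsplit]
    linarith
  have hK : 0 < Real.exp C * ε := by positivity
  have htop : (∫⁻ y in Ioc (0:ℝ) ε, ENNReal.ofReal (Real.exp C * ε * y⁻¹)) = ⊤ := by
    by_contra hne
    have hint : IntegrableOn (fun y : ℝ => Real.exp C * ε * y⁻¹) (Ioc 0 ε) := by
      refine ⟨(measurable_inv.const_mul _).aestronglyMeasurable, ?_⟩
      rw [hasFiniteIntegral_iff_ofReal]
      · exact lt_top_iff_ne_top.mpr hne
      · filter_upwards [ae_restrict_mem measurableSet_Ioc] with y hy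
        have := hy.1
        simp only [Pi.zero_apply]
        positivity
    have h2 : IntervalIntegrable (fun y : ℝ => y⁻¹) volume 0 ε := by
      rw [intervalIntegrable_iff_integrableOn_Ioc_of_le hε0.le]
      have := hint.const_mul (Real.exp C * ε)⁻¹
      refine this.congr (Filter.Eventually.of_forall fun y => ?_)
      simp only
      rw [← mul_assoc, inv_mul_cancel₀ hK.ne', one_mul]
    rw [intervalIntegrable_inv_iff] at h2
    rcases h2 with h2 | h2
    · exact hε0.ne h2
    · exact h2 left_mem_uIcc
  rw [eq_top_iff, ← htop]
  calc _ ≤ ∫⁻ y in Ioc (0:ℝ) ε, ENNReal.ofReal (scaleDensity 1 bd a y) :=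
        setLIntegral_mono' measurableSet_Ioc fun y hy => ENNReal.ofReal_le_ofReal (hs y hy)
    _ ≤ _ := lintegral_mono_set (Ioc_subset_Ioc_right hεb)
end

section
/- Suppose β = 1, b_d(0) > 0, 2 b_d(0) < a(0), and there exist constants γ ∈ (0,1], L > 0 and κ ∈ (0,1) such that |b_d(y) − b_d(0)| ≤ L y^γ for all y ∈ [0,κ]. Then for every b ∈ (0,1), both the scale measure S(0,b] = ∫_0^b s(y) dy and the speed measure M(0,b] = ∫_0^b m(y) dy are finite. (This is the analytic content of Lemma 4.1(3)(ii): the origin is a regular boundary for the diffusion X^{(d)}.) -/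
open MeasureTheory Set

/-- A continuous function on `[0,1]` is bounded above by an affine function whose value at the
origin is any number larger than `g 0`. -/
lemma affine_upper_bound (g : ℝ → ℝ) (hg : ContinuousOn g (Icc 0 1)) (q : ℝ) (hq : g 0 < q) :
    ∃ C : ℝ, 0 ≤ C ∧ ∀ y ∈ Icc (0 : ℝ) 1, g y ≤ q + C * y := by
  have h0 : (0 : ℝ) ∈ Icc (0 : ℝ) 1 := by simp
  have hev : ∀ᶠ y in nhdsWithin 0 (Icc (0 : ℝ) 1), g y < q :=
    (hg 0 h0).eventually (Iio_mem_nhds hq)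
  obtain ⟨ε, hε, hball⟩ := Metric.mem_nhdsWithin_iff.1 hev
  obtain ⟨K, hK⟩ := isCompact_Icc.exists_bound_of_continuousOn hg
  refine ⟨(|K| + |q|) / ε, by positivity, fun y hy => ?_⟩
  by_cases hyε : y < ε
  · have : g y < q := hball ⟨by simpa [abs_of_nonneg hy.1] using hyε, hy⟩
    have h2 : 0 ≤ (|K| + |q|) / ε * y := mul_nonneg (by positivity) hy.1
    linarith
  · have h1 : (|K| + |q|) ≤ (|K| + |q|) / ε * y := by
      rw [div_mul_eq_mul_div, le_div_iff₀ hε]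
      exact mul_le_mul_of_nonneg_left (not_lt.1 hyε) (by positivity)
    have h3 := hK y hy
    rw [Real.norm_eq_abs] at h3
    have := le_abs_self (g y)
    have := le_abs_self K
    have := neg_abs_le q
    linarith

/-- Upper bound for `∫_y^1 g(η)/η dη`. -/
lemma integral_upper_bound (g : ℝ → ℝ) (hg : ContinuousOn g (Icc 0 1)) (q C : ℝ) (hC : 0 ≤ C)
    (h : ∀ y ∈ Icc (0 : ℝ) 1, g y ≤ q + C * y) (y : ℝ) (hy : y ∈ Ioc (0 : ℝ) 1) :
    ∫ η in y..1, g η / η ≤ -q * Real.log y + C := by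
  have hsub : Icc y 1 ⊆ Icc (0 : ℝ) 1 := Icc_subset_Icc_left hy.1.le
  have hne : ∀ x ∈ Icc y 1, x ≠ 0 := fun x hx => (hy.1.trans_le hx.1).ne'
  have i1 : IntervalIntegrable (fun η => g η / η) volume y 1 :=
    ContinuousOn.intervalIntegrable (by
      rw [uIcc_of_le hy.2]
      exact (hg.mono hsub).div continuousOn_id hne)
  have i3 : IntervalIntegrable (fun η : ℝ => q * η⁻¹) volume y 1 :=
    ContinuousOn.intervalIntegrable (by
      rw [uIcc_of_le hy.2]
      exact continuousOn_const.mul (continuousOn_id.inv₀ hne))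
  have i4 : IntervalIntegrable (fun _ : ℝ => C) volume y 1 := intervalIntegrable_const
  have hle : ∫ η in y..1, g η / η ≤ ∫ η in y..1, (q * η⁻¹ + C) := by
    refine intervalIntegral.integral_mono_on hy.2 i1 (i3.add i4) fun x hx => ?_
    have hx0 : 0 < x := hy.1.trans_le hx.1
    rw [div_le_iff₀ hx0, add_mul, mul_assoc, inv_mul_cancel₀ hx0.ne', mul_one]
    exact h x (hsub hx)
  rw [intervalIntegral.integral_add i3 i4, intervalIntegral.integral_const_mul,
    integral_inv_of_pos hy.1 one_pos, intervalIntegral.integral_const, smul_eq_mul, one_div,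
    Real.log_inv] at hle
  nlinarith [hy.1]

/-- A function dominated by an integrable power has finite integral near the origin. -/
lemma lintegral_lt_top_of_le_rpow (f : ℝ → ℝ) (b K r : ℝ) (hb : b ∈ Ioo (0 : ℝ) 1)
    (hr : -1 < r) (h : ∀ y ∈ Ioc (0 : ℝ) 1, f y ≤ K * y ^ r) :
    (∫⁻ y in Ioc (0 : ℝ) b, ENNReal.ofReal (f y)) < ⊤ := by
  have hi : IntegrableOn (fun y : ℝ => K * y ^ r) (Ioc 0 b) :=
    (intervalIntegrable_iff_integrableOn_Ioc_of_le hb.1.le).1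
      ((intervalIntegral.intervalIntegrable_rpow' hr).const_mul K)
  refine lt_of_le_of_lt (setLIntegral_mono' measurableSet_Ioc fun y hy =>
    ENNReal.ofReal_le_ofReal (h y ⟨hy.1, hy.2.trans hb.2.le⟩)) ?_
  exact hi.lintegral_lt_top

/-- If `β = 1`, `b_d(0) > 0`, `2 b_d(0) < a(0)` and `b_d` is locally Hölder continuous at
the origin, then for every `b ∈ (0,1)` both the scale measure `S(0,b] = ∫_0^b s(y) dy`
and the speed measure `M(0,b] = ∫_0^b m(y) dy` are finite. -/
theorem scale_and_speed_measure_finite_of_beta_eq_one_subcritical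
    (δ : ℝ) (hδ : 0 < δ)
    (bd a : ℝ → ℝ) (hbd : ContinuousOn bd (Set.Icc 0 1))
    (ha : ContinuousOn a (Set.Icc 0 1))
    (haδ : ∀ y ∈ Set.Icc (0 : ℝ) 1, δ ≤ a y)
    (hbd0 : 0 < bd 0) (hsub : 2 * bd 0 < a 0)
    (γ L κ : ℝ) (hγ : γ ∈ Set.Ioc (0 : ℝ) 1) (hL : 0 < L) (hκ : κ ∈ Set.Ioo (0 : ℝ) 1)
    (hholder : ∀ y ∈ Set.Icc (0 : ℝ) κ, |bd y - bd 0| ≤ L * y ^ γ) :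
    ∀ b ∈ Set.Ioo (0 : ℝ) 1,
      (∫⁻ y in Set.Ioc (0 : ℝ) b, ENNReal.ofReal (scaleDensity 1 bd a y)) < ⊤ ∧
      (∫⁻ y in Set.Ioc (0 : ℝ) b, ENNReal.ofReal (speedDensity 1 bd a y)) < ⊤ := by
  intro b hb
  set g : ℝ → ℝ := fun y => 2 * bd y / a y with hgdef
  have hapos : ∀ y ∈ Icc (0 : ℝ) 1, 0 < a y := fun y hy => hδ.trans_le (haδ y hy)
  have ha0 : 0 < a 0 := hapos 0 (by simp)
  have hg : ContinuousOn g (Icc 0 1) :=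
    (continuousOn_const.mul hbd).div ha fun y hy => (hapos y hy).ne'
  have hg0 : 0 < g 0 := by simp only [hgdef]; positivity
  have hg1 : g 0 < 1 := by simp only [hgdef]; rwa [div_lt_one ha0]
  obtain ⟨q, hq0, hq1⟩ := exists_between hg1
  obtain ⟨p, hp0, hp1⟩ := exists_between hg0
  obtain ⟨C, hC, hCb⟩ := affine_upper_bound g hg q hq0
  obtain ⟨D, hD, hDb⟩ := affine_upper_bound (fun y => -g y) hg.neg (-p) (neg_lt_neg hp1)
  have hs : ∀ y, scaleDensity 1 bd a y = Real.exp (∫ η in y..1, g η / η) := by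
    intro y
    unfold scaleDensity
    congr 2
    funext η
    simp only [hgdef, Real.rpow_one]
    rw [div_div, mul_comm]
    ring
  constructor
  · refine lintegral_lt_top_of_le_rpow _ b (Real.exp C) (-q) hb (by linarith) fun y hy => ?_
    rw [hs, Real.rpow_def_of_pos hy.1, ← Real.exp_add, Real.exp_le_exp]
    have := integral_upper_bound g hg q C hC hCb y hy
    linarith
  · refine lintegral_lt_top_of_le_rpow _ b (Real.exp D / δ) (p - 1) hb (by linarith)
      fun y hy => ?_
    have hup := integral_upper_bound (fun y => -g y) hg.neg (-p) D hD hDb y hy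
    simp only [neg_div, intervalIntegral.integral_neg, neg_neg] at hup
    have hE : Real.exp (-∫ η in y..1, g η / η) ≤ Real.exp D * y ^ p := by
      rw [Real.rpow_def_of_pos hy.1, ← Real.exp_add, Real.exp_le_exp]
      linarith
    have hay : δ ≤ a y := haδ y ⟨hy.1.le, hy.2⟩
    have hy0 := hy.1
    have hinv : (a y)⁻¹ ≤ δ⁻¹ := inv_anti₀ hδ hay
    have hainv : 0 ≤ (a y)⁻¹ := inv_nonneg.2 (hδ.le.trans hay)
    unfold speedDensity
    rw [hs, Real.rpow_one, Real.rpow_sub_one hy0.ne', one_div, mul_inv, mul_inv, ← Real.exp_neg]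
    calc y⁻¹ * (a y)⁻¹ * Real.exp (-∫ η in y..1, g η / η)
        ≤ y⁻¹ * δ⁻¹ * (Real.exp D * y ^ p) := by gcongr
      _ = Real.exp D / δ * (y ^ p / y) := by field_simp
end

section
/- Suppose β = 1, b_d(0) > 0, 2 b_d(0) = a(0), there exist constants γ ∈ (0,1], L > 0 and κ ∈ (0,1) such that |b_d(y) − b_d(0)| ≤ L y^γ for all y ∈ [0,κ], and there exists κ₂ ∈ (0,κ) such that a(y) = a(0) for all y ∈ [0,κ₂]. Then for every b ∈ (0,1), the scale measure S(0,b] = ∫_0^b s(y) dy is infinite. (This is the analytic content of Lemma 4.1(3)(iii): the origin is a non-attracting natural or entrance boundary for the diffusion X^{(d)}.) -/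
open MeasureTheory Set

/-- If `β = 1`, `b_d(0) > 0`, `2 b_d(0) = a(0)`, `b_d` is locally Hölder continuous at the
origin, and `a` is constant in a neighborhood of the origin, then for every `b ∈ (0,1)` the
scale measure `S(0,b] = ∫_0^b s(y) dy` is infinite. -/
theorem scale_measure_infinite_of_beta_eq_one_critical
    (δ : ℝ) (hδ : 0 < δ)
    (bd a : ℝ → ℝ) (hbd : ContinuousOn bd (Set.Icc 0 1))
    (ha : ContinuousOn a (Set.Icc 0 1))
    (haδ : ∀ y ∈ Set.Icc (0 : ℝ) 1, δ ≤ a y)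
    (hbd0 : 0 < bd 0) (hcrit : 2 * bd 0 = a 0)
    (γ L κ : ℝ) (hγ : γ ∈ Set.Ioc (0 : ℝ) 1) (hL : 0 < L) (hκ : κ ∈ Set.Ioo (0 : ℝ) 1)
    (hholder : ∀ y ∈ Set.Icc (0 : ℝ) κ, |bd y - bd 0| ≤ L * y ^ γ)
    (hconst : ∃ κ₂ ∈ Set.Ioo (0 : ℝ) κ, ∀ y ∈ Set.Icc (0 : ℝ) κ₂, a y = a 0) :
    ∀ b ∈ Set.Ioo (0 : ℝ) 1,
      (∫⁻ y in Set.Ioc (0 : ℝ) b, ENNReal.ofReal (scaleDensity 1 bd a y)) = ⊤ := by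
  intro b hb
  obtain ⟨c, hc, hac⟩ := hconst
  have hc0 : 0 < c := hc.1
  have hcκ : c < κ := hc.2
  have hc1 : c < 1 := hc.2.trans hκ.2
  have ha0 : 0 < a 0 := hcrit ▸ (by linarith)
  have hγ0 : 0 < γ := hγ.1
  have hint : ∀ u v : ℝ, 0 < u → u ≤ v → v ≤ 1 →
      IntervalIntegrable (fun η : ℝ => 2 * bd η / (η ^ (1 : ℝ) * a η)) volume u v := by
    intro u v hu huv hv
    apply ContinuousOn.intervalIntegrable
    rw [uIcc_of_le huv]
    have hsub : Icc u v ⊆ Icc (0 : ℝ) 1 := Icc_subset_Icc hu.le hv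
    simp only [Real.rpow_one]
    refine ContinuousOn.div (continuousOn_const.mul (hbd.mono hsub))
      (continuousOn_id.mul (ha.mono hsub)) ?_
    intro x hx
    have h1 : 0 < x := hu.trans_le hx.1
    have h2 : 0 < a x := hδ.trans_le (haδ x (hsub hx))
    exact (mul_pos h1 h2).ne'
  set J : ℝ := ∫ η in c..1, 2 * bd η / (η ^ (1 : ℝ) * a η) with hJ
  set D : ℝ := 2 * L / a 0 with hD
  have hD0 : 0 < D := by positivity
  set K : ℝ := Real.exp (Real.log c - D * (c ^ γ / γ) + J) with hK
  have hK0 : 0 < K := Real.exp_pos _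
  have hlow : ∀ y ∈ Ioc (0 : ℝ) c, K * y⁻¹ ≤ scaleDensity 1 bd a y := by
    intro y hy
    have hy0 := hy.1
    have hi1 : IntervalIntegrable (fun η : ℝ => η⁻¹) volume y c := by
      apply intervalIntegral.intervalIntegrable_inv
      · intro x hx
        rw [uIcc_of_le hy.2] at hx
        exact (hy0.trans_le hx.1).ne'
      · exact continuousOn_id
    have hi2 : IntervalIntegrable (fun η : ℝ => η ^ (γ - 1)) volume y c :=
      intervalIntegral.intervalIntegrable_rpow' (by linarith)
    have hmono : ∫ η in y..c, (η⁻¹ - D * η ^ (γ - 1)) ≤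
        ∫ η in y..c, 2 * bd η / (η ^ (1 : ℝ) * a η) := by
      apply intervalIntegral.integral_mono_on hy.2 (hi1.sub (hi2.const_mul D))
        (hint y c hy0 hy.2 hc1.le)
      intro x hx
      have hx0 : 0 < x := hy0.trans_le hx.1
      have h := (abs_le.mp (hholder x ⟨hx0.le, hx.2.trans hcκ.le⟩)).1
      rw [hac x ⟨hx0.le, hx.2⟩, Real.rpow_one, Real.rpow_sub hx0, Real.rpow_one, hD]
      have e : x⁻¹ - 2 * L / a 0 * (x ^ γ / x) = (a 0 - 2 * L * x ^ γ) / (x * a 0) := by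
        field_simp
      rw [e]
      gcongr
      linarith
    rw [intervalIntegral.integral_sub hi1 (hi2.const_mul D),
      intervalIntegral.integral_const_mul, integral_inv_of_pos hy0 hc0,
      integral_rpow (Or.inl (by linarith)), Real.log_div hc0.ne' hy0.ne',
      sub_add_cancel] at hmono
    have hsplit := intervalIntegral.integral_add_adjacent_intervals
      (hint y c hy0 hy.2 hc1.le) (hint c 1 hc0 hc1.le le_rfl)
    have hle : D * ((c ^ γ - y ^ γ) / γ) ≤ D * (c ^ γ / γ) := by
      have : 0 ≤ y ^ γ := Real.rpow_nonneg hy0.le _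
      gcongr
      linarith
    have e2 : K * y⁻¹ = Real.exp (Real.log c - D * (c ^ γ / γ) + J - Real.log y) := by
      rw [Real.exp_sub, Real.exp_log hy0, hK]; rfl
    rw [e2, scaleDensity, ← hsplit]
    apply Real.exp_le_exp.mpr
    linarith
  set m : ℝ := min b c with hm
  have hm0 : 0 < m := lt_min hb.1 hc0
  have htop : (∫⁻ y in Ioc (0 : ℝ) m, ENNReal.ofReal (K * y⁻¹)) = ⊤ := by
    by_contra hne
    have hmeas : AEStronglyMeasurable (fun y : ℝ => K * y⁻¹) (volume.restrict (Ioc 0 m)) :=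
      (measurable_inv.const_mul K).aestronglyMeasurable
    have hnn : 0 ≤ᵐ[volume.restrict (Ioc 0 m)] (fun y : ℝ => K * y⁻¹) := by
      filter_upwards [ae_restrict_mem measurableSet_Ioc] with y hy
      have := hy.1
      positivity
    have hI : Integrable (fun y : ℝ => K * y⁻¹) (volume.restrict (Ioc 0 m)) :=
      (lintegral_ofReal_ne_top_iff_integrable hmeas hnn).mp hne
    have hI2 : IntervalIntegrable (fun y : ℝ => y⁻¹) volume 0 m := by
      rw [intervalIntegrable_iff_integrableOn_Ioc_of_le hm0.le]
      have := hI.const_mul K⁻¹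
      refine this.congr (Filter.Eventually.of_forall fun y => ?_)
      simp only
      field_simp
    rw [intervalIntegrable_inv_iff] at hI2
    rcases hI2 with h | h
    · exact hm0.ne h
    · exact h left_mem_uIcc
  rw [eq_top_iff, ← htop]
  calc (∫⁻ y in Ioc (0 : ℝ) m, ENNReal.ofReal (K * y⁻¹))
      ≤ ∫⁻ y in Ioc (0 : ℝ) m, ENNReal.ofReal (scaleDensity 1 bd a y) :=
        setLIntegral_mono' measurableSet_Ioc fun y hy =>
          ENNReal.ofReal_le_ofReal (hlow y ⟨hy.1, hy.2.trans (min_le_right _ _)⟩)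
    _ ≤ _ := lintegral_mono_set (Ioc_subset_Ioc_right (min_le_left _ _))
end

section
/- Let l < b be real numbers and let s, m : (l,b] → (0,∞) be continuous functions. For y ∈ (l,b] set S(l,y] := ∫_l^y s(ζ) dζ and M[y,b] := ∫_y^b m(ξ) dξ (values in [0,∞]). If ∫_l^b S(l,ξ] · m(ξ) dξ < ∞, then lim_{a ↓ l} S(l,a] · M[a,b] = 0. (This is the key limit claim in the proof of the exit-boundary case of Lemma 3.1, established by integration by parts and Fubini's theorem.) -/
open MeasureTheory Set Filter

/-- If `∫_l^b S(l,ξ] m(ξ) dξ < ∞`, where `S(l,y] = ∫_l^y s(ζ) dζ`, then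
`S(l,a] · M[a,b] → 0` as `a ↓ l`, where `M[a,b] = ∫_a^b m(ξ) dξ`. -/
theorem scale_mul_speed_tendsto_zero
    (l b : ℝ) (hlb : l < b) (s m : ℝ → ℝ)
    (hs : ContinuousOn s (Set.Ioc l b)) (hm : ContinuousOn m (Set.Ioc l b))
    (hspos : ∀ y ∈ Set.Ioc l b, 0 < s y) (hmpos : ∀ y ∈ Set.Ioc l b, 0 < m y)
    (hSigma : (∫⁻ ξ in Set.Ioc l b,
        (∫⁻ ζ in Set.Ioc l ξ, ENNReal.ofReal (s ζ)) * ENNReal.ofReal (m ξ)) < ⊤) :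
    Tendsto
      (fun a : ℝ => (∫⁻ ζ in Set.Ioc l a, ENNReal.ofReal (s ζ)) *
        (∫⁻ ξ in Set.Icc a b, ENNReal.ofReal (m ξ)))
      (nhdsWithin l (Set.Ioi l)) (nhds 0) := by
  set S : ℝ → ENNReal := fun a => ∫⁻ ζ in Set.Ioc l a, ENNReal.ofReal (s ζ) with hS
  have hmono : ∀ x y, x ≤ y → S x ≤ S y := fun x y h =>
    lintegral_mono_set (Ioc_subset_Ioc_right h)
  -- finiteness of S somewhere
  have hfin : ∃ c ∈ Ioc l b, S c ≠ ⊤ := by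
    by_contra! hcon
    have h1 : (∫⁻ ξ in Set.Ioc l b, S ξ * ENNReal.ofReal (m ξ))
        = ∫⁻ ξ in Set.Ioc l b, (⊤ : ENNReal) := by
      refine setLIntegral_congr_fun measurableSet_Ioc ?_
      intro x hx
      simp only [hcon x hx]
      exact ENNReal.top_mul (by simpa using hmpos x hx)
    have h2 : (∫⁻ ξ in Set.Ioc l b, S ξ * ENNReal.ofReal (m ξ)) < ⊤ := hSigma
    rw [h1, setLIntegral_const, Real.volume_Ioc, ENNReal.top_mul (by simpa using hlb)] at h2
    exact lt_irrefl _ h2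
  obtain ⟨c, hc, hcfin⟩ := hfin
  -- S tends to zero
  have hvol : Tendsto (fun a : ℝ => volume.restrict (Ioc l c) (Ioc l a))
      (nhdsWithin l (Ioi l)) (nhds 0) := by
    have h0 : Tendsto (fun a : ℝ => ENNReal.ofReal (a - l)) (nhdsWithin l (Ioi l)) (nhds 0) := by
      have : Continuous (fun a : ℝ => ENNReal.ofReal (a - l)) :=
        ENNReal.continuous_ofReal.comp (continuous_id.sub continuous_const)
      simpa using (this.tendsto l).mono_left nhdsWithin_le_nhds
    refine tendsto_of_tendsto_of_tendsto_of_le_of_le tendsto_const_nhds h0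
      (fun _ => zero_le) (fun a => ?_)
    exact (Measure.restrict_apply_le _ _).trans (by simp)
  have hS0 : Tendsto S (nhdsWithin l (Ioi l)) (nhds 0) := by
    have := tendsto_setLIntegral_zero (f := fun ζ => ENNReal.ofReal (s ζ)) hcfin hvol
    refine this.congr' ?_
    filter_upwards [Ioc_mem_nhdsGT hc.1] with a ha
    rw [Measure.restrict_restrict measurableSet_Ioc,
      inter_eq_left.mpr (Ioc_subset_Ioc_right ha.2)]
  have hmeas : AEMeasurable (fun x => ENNReal.ofReal (m x)) (volume.restrict (Ioc l b)) :=
    (hm.aemeasurable measurableSet_Ioc).ennreal_ofReal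
  refine tendsto_of_seq_tendsto fun u hu => ?_
  have hdct := tendsto_lintegral_of_dominated_convergence' (μ := volume.restrict (Ioc l b))
    (F := fun n x => (Icc (max (u n) l) b).indicator
      (fun x => S (u n) * ENNReal.ofReal (m x)) x) (f := fun _ => 0)
    (fun x => S x * ENNReal.ofReal (m x))
    (fun n => (hmeas.const_mul _).indicator measurableSet_Icc)
    (fun n => ?_) hSigma.ne ?_
  · rw [lintegral_zero] at hdct
    refine hdct.congr' ?_
    filter_upwards [hu.eventually self_mem_nhdsWithin,
      hu.eventually (Ioc_mem_nhdsGT hc.1)] with n hn hn2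
    have hn' : l < u n := hn
    have hfinn : S (u n) ≠ ⊤ := ne_top_of_le_ne_top hcfin (hmono _ _ hn2.2)
    have hsub : Icc (u n) b ⊆ Ioc l b := fun x hx => ⟨hn'.trans_le hx.1, hx.2⟩
    rw [max_eq_left hn'.le, lintegral_indicator measurableSet_Icc,
      Measure.restrict_restrict measurableSet_Icc,
      inter_eq_left.mpr hsub,
      lintegral_const_mul' _ _ hfinn]
    rfl
  · refine Eventually.of_forall fun x => ?_
    by_cases hx : x ∈ Icc (max (u n) l) b
    · simp only [indicator_of_mem hx]
      have := hmono _ _ ((le_max_left _ _).trans hx.1)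
      gcongr
    · simp only [indicator_of_notMem hx]
      exact zero_le
  · refine Eventually.of_forall fun x => ?_
    have h3 : Tendsto (fun n => S (u n) * ENNReal.ofReal (m x)) atTop (nhds 0) := by
      have := ENNReal.Tendsto.mul_const (b := ENNReal.ofReal (m x)) (hS0.comp hu)
        (Or.inr ENNReal.ofReal_ne_top)
      simpa using this
    refine tendsto_of_tendsto_of_tendsto_of_le_of_le tendsto_const_nhds h3
      (fun _ => zero_le) (fun n => ?_)
    exact indicator_le_self _ _ x
end
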